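/- Suppose h(z) = Σ a_n z^n and g(z) = Σ b_n z^n are analytic on the unit disk with |g'(z)| ≤ k|h'(z)| for all z ∈ 𝔻, where k ∈ (0,1]. Then Σ_{n≥1} |b_n| r^n ≤ k Σ_{n≥1} |a_n| r^n for all 0 ≤ r ≤ 1/3. -/

import Mathlib

section

open Filter Topology Metric Real

theorem norm_circleAverage_le_of_norm_le {f : ℂ → ℂ} {g : ℂ → ℝ} {c : ℂ} {R : ℝ}
    (hg : CircleIntegrable g c R) (h : ∀ z ∈ sphere c |R|, ‖f z‖ ≤ g z) :
    ‖circleAverage f c R‖ ≤ circleAverage g c R := by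
  rw [circleAverage_def, circleAverage_def, norm_smul, smul_eq_mul,
    norm_of_nonneg (by positivity)]
  gcongr
  exact intervalIntegral.norm_integral_le_of_norm_le two_pi_pos.le
    (.of_forall fun θ _ => h _ (circleMap_mem_sphere' c R θ)) hg

/-- The circle average of a holomorphic function against the kernel `2 + 2 Re(conj d (z / R) ^ n)`
isolates the constant and the `n`-th Taylor coefficients. -/
theorem circleAverage_mul_kernel {f : ℂ → ℂ} (hf : DifferentiableOn ℂ f (ball 0 1)) {R : ℝ}
    (hR0 : 0 < R) (hR1 : R < 1) {n : ℕ} (hn : n ≠ 0) (d : ℂ) :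
    circleAverage (fun z => f z * (2 + (starRingEnd ℂ) d * z ^ n / R ^ n + d * R ^ n / z ^ n)) 0 R =
      2 * f 0 + d * R ^ n * (iteratedDeriv n f 0 / n.factorial) := by
  have hRc : (R : ℂ) ≠ 0 := by exact_mod_cast hR0.ne'
  have hfc : DifferentiableOn ℂ f (closedBall 0 R) := hf.mono (closedBall_subset_ball hR1)
  have hfs : ContinuousOn f (sphere 0 |R|) := by
    rw [abs_of_pos hR0]; exact hfc.continuousOn.mono sphere_subset_closedBall
  have hz : ∀ z ∈ sphere (0 : ℂ) |R|, z ^ n ≠ 0 := fun z hz => by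
    apply pow_ne_zero
    rintro rfl
    simp [abs_of_pos hR0, hR0.ne] at hz
  have h1 : DifferentiableOn ℂ (fun z => f z * (2 + (starRingEnd ℂ) d * z ^ n / R ^ n))
      (closedBall 0 R) := hfc.mul (by fun_prop)
  have hc1 : ContinuousOn (fun z => f z * (2 + (starRingEnd ℂ) d * z ^ n / R ^ n))
      (sphere 0 |R|) := hfs.mul (by fun_prop)
  have hc2 : ContinuousOn (fun z => f z * (d * R ^ n / z ^ n)) (sphere 0 |R|) :=
    hfs.mul (continuousOn_const.div (by fun_prop) hz)
  simp_rw [mul_add (f _) (2 + _)]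
  rw [circleAverage_fun_add hc1.circleIntegrable' hc2.circleIntegrable']
  congr 1
  · rw [DiffContOnCl.circleAverage (f := fun z => f z * (2 + (starRingEnd ℂ) d * z ^ n / R ^ n))]
    · simp [hn, mul_comm]
    · rw [abs_of_pos hR0]
      exact (h1.mono closure_ball_subset_closedBall).diffContOnCl
  · rw [circleAverage_eq_circleIntegral hR0.ne']
    have := hfc.circleIntegral_one_div_sub_center_pow_smul hR0 n
    have e : ∀ z : ℂ, (z - 0)⁻¹ • (f z * (d * R ^ n / z ^ n)) =
        (d * R ^ n) • ((1 / (z - 0) ^ (n + 1)) • f z) := fun z => by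
      simp only [smul_eq_mul, sub_zero, pow_succ, div_eq_mul_inv, mul_inv, one_mul]; ring
    simp_rw [e]
    rw [circleIntegral.integral_smul, this]
    have := Complex.two_pi_I_ne_zero
    simp only [smul_eq_mul]
    field_simp

theorem exists_norm_one_mul_eq_norm (z : ℂ) : ∃ u : ℂ, ‖u‖ = 1 ∧ u * z = ‖z‖ := by
  rcases eq_or_ne z 0 with rfl | hz
  · exact ⟨1, by simp⟩
  · refine ⟨‖z‖ / z, ?_, ?_⟩
    · simp [hz]
    · field_simp

theorem two_mul_norm_add_pow_mul_norm_coeff_le {f : ℂ → ℂ} {k : ℝ}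
    (hf : DifferentiableOn ℂ f (ball 0 1)) (hk : ∀ z ∈ ball (0 : ℂ) 1, ‖f z‖ ≤ k) {R : ℝ}
    (hR0 : 0 < R) (hR1 : R < 1) {n : ℕ} (hn : n ≠ 0) :
    2 * ‖f 0‖ + R ^ n * ‖iteratedDeriv n f 0 / n.factorial‖ ≤ 2 * k := by
  obtain ⟨u, hu, hu'⟩ := exists_norm_one_mul_eq_norm (f 0)
  obtain ⟨v, hv, hv'⟩ := exists_norm_one_mul_eq_norm (iteratedDeriv n f 0 / n.factorial)
  have hu0 : u ≠ 0 := by rintro rfl; simp at hu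
  set d := v / u with hd
  have hd1 : ‖d‖ = 1 := by simp [hd, hu, hv]
  set K : ℂ → ℂ := fun z => 2 + (starRingEnd ℂ) d * z ^ n / R ^ n + d * R ^ n / z ^ n with hK
  have hRc : (R : ℂ) ≠ 0 := by exact_mod_cast hR0.ne'
  have hKr : ∀ z ∈ sphere (0 : ℂ) |R|, ∃ t : ℝ, 0 ≤ t ∧ K z = t := by
    intro z hz
    rw [abs_of_pos hR0, mem_sphere_zero_iff_norm] at hz
    have hz0 : z ≠ 0 := by rintro rfl; simp [hR0.ne] at hz
    set x := d * R ^ n / z ^ n with hx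
    have hx1 : ‖x‖ = 1 := by
      simp [hx, hd1, hz, abs_of_pos hR0, hR0.ne']
    have hzz : (starRingEnd ℂ) z = R ^ 2 / z := by
      rw [eq_div_iff hz0, mul_comm, Complex.mul_conj, Complex.normSq_eq_norm_sq, hz]; simp
    have hxc : (starRingEnd ℂ) x = (starRingEnd ℂ) d * z ^ n / R ^ n := by
      simp only [hx, map_div₀, map_mul, map_pow, Complex.conj_ofReal, hzz, div_pow]
      field_simp
      ring
    refine ⟨2 + 2 * x.re, ?_, ?_⟩
    · have := Complex.abs_re_le_norm x
      rw [hx1] at this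
      linarith [(abs_le.1 this).1]
    · rw [hK]
      simp only
      rw [← hxc, ← hx, add_assoc, add_comm ((starRingEnd ℂ) x), Complex.add_conj]
      push_cast; ring
  have hKc : ContinuousOn K (sphere 0 |R|) := by
    have hz : ∀ z ∈ sphere (0 : ℂ) |R|, z ^ n ≠ 0 := fun z hz => by
      apply pow_ne_zero
      rintro rfl
      simp [abs_of_pos hR0, hR0.ne] at hz
    have hpoly : Continuous fun z : ℂ => 2 + (starRingEnd ℂ) d * z ^ n / R ^ n := by fun_prop
    exact hpoly.continuousOn.add (continuousOn_const.div (by fun_prop) hz)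
  have key := circleAverage_mul_kernel hf hR0 hR1 hn d
  have one := circleAverage_mul_kernel (f := fun _ => 1) (by fun_prop) hR0 hR1 hn d
  have hone : circleAverage (fun z => k * (K z).re) 0 R = 2 * k := by
    have h2 := Complex.reCLM.circleAverage_comp_comm (f := K) (c := 0) (R := R)
      hKc.circleIntegrable'
    have h3 : circleAverage K 0 R = 2 := by
      simpa [iteratedDeriv_const, hn] using one
    rw [h3] at h2
    have h4 := circleAverage_fun_smul (a := k) (f := fun z => (K z).re) (c := 0) (R := R)
    simp only [smul_eq_mul] at h4
    rw [h4, mul_comm]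
    congr 1
  have hle : ‖circleAverage (fun z => f z * K z) 0 R‖ ≤ 2 * k := by
    rw [← hone]
    apply norm_circleAverage_le_of_norm_le
    · exact (continuousOn_const.mul (Complex.continuous_re.comp_continuousOn hKc)).circleIntegrable'
    · intro z hz
      obtain ⟨t, ht, e⟩ := hKr z hz
      rw [e, norm_mul, Complex.ofReal_re, Complex.norm_of_nonneg ht]
      gcongr
      apply hk
      rw [abs_of_pos hR0] at hz
      exact closedBall_subset_ball hR1 (sphere_subset_closedBall hz)
  rw [key] at hle
  refine le_trans (le_of_eq ?_) hle
  rw [← one_mul ‖_ + _‖, ← hu, ← norm_mul]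
  have : u * (2 * f 0 + d * R ^ n * (iteratedDeriv n f 0 / n.factorial)) =
      ((2 * ‖f 0‖ + R ^ n * ‖iteratedDeriv n f 0 / n.factorial‖ : ℝ) : ℂ) := by
    push_cast
    rw [← hu', ← hv', hd]
    field_simp
  rw [this, Complex.norm_of_nonneg (by positivity)]

/-- If `f` is holomorphic on the unit disk and bounded there by `k`, its Taylor coefficients
of positive index are at most `2 (k - ‖f 0‖)`. -/
theorem norm_taylorCoeff_le {f : ℂ → ℂ} {k : ℝ}
    (hf : DifferentiableOn ℂ f (ball 0 1)) (hk : ∀ z ∈ ball (0 : ℂ) 1, ‖f z‖ ≤ k)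
    {n : ℕ} (hn : n ≠ 0) :
    ‖iteratedDeriv n f 0 / n.factorial‖ ≤ 2 * (k - ‖f 0‖) := by
  have hlim : Tendsto (fun R : ℝ => 2 * ‖f 0‖ + R ^ n * ‖iteratedDeriv n f 0 / n.factorial‖)
      (𝓝[<] 1) (𝓝 (2 * ‖f 0‖ + 1 ^ n * ‖iteratedDeriv n f 0 / n.factorial‖)) :=
    ((by fun_prop : Continuous fun R : ℝ =>
      2 * ‖f 0‖ + R ^ n * ‖iteratedDeriv n f 0 / n.factorial‖).tendsto 1).mono_left
      nhdsWithin_le_nhds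
  have := le_of_tendsto hlim (b := 2 * k) (by
    filter_upwards [Ioo_mem_nhdsLT (zero_lt_one' ℝ)] with R hR
    exact two_mul_norm_add_pow_mul_norm_coeff_le hf hk hR.1 hR.2 hn)
  rw [one_pow, one_mul] at this
  linarith

/-- **Bohr's inequality** for holomorphic functions bounded by `k` on the unit disk. -/
theorem bohr_inequality {f : ℂ → ℂ} {k : ℝ}
    (hf : DifferentiableOn ℂ f (ball 0 1)) (hk : ∀ z ∈ ball (0 : ℂ) 1, ‖f z‖ ≤ k)
    {r : ℝ} (hr0 : 0 ≤ r) (hr : r ≤ 1 / 3) :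
    Summable (fun n : ℕ => ‖iteratedDeriv n f 0 / n.factorial‖ * r ^ n) ∧
      ∑' n : ℕ, ‖iteratedDeriv n f 0 / n.factorial‖ * r ^ n ≤ k := by
  have hgeo : HasSum (fun n : ℕ => 2 * (k - ‖f 0‖) * (1 / 3) * (1 / 3 : ℝ) ^ n) (k - ‖f 0‖) := by
    convert! (hasSum_geometric_of_lt_one (r := (1 / 3 : ℝ)) (by norm_num) (by norm_num)).mul_left
      (2 * (k - ‖f 0‖) * (1 / 3)) using 1
    ring
  have hle : ∀ n : ℕ, ‖iteratedDeriv (n + 1) f 0 / (n + 1).factorial‖ * r ^ (n + 1) ≤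
      2 * (k - ‖f 0‖) * (1 / 3) * (1 / 3 : ℝ) ^ n := fun n => by
    have h := norm_taylorCoeff_le hf hk n.succ_ne_zero
    calc _ ≤ 2 * (k - ‖f 0‖) * (1 / 3) ^ (n + 1) :=
          mul_le_mul h (pow_le_pow_left₀ hr0 hr _) (by positivity) ((norm_nonneg _).trans h)
      _ = _ := by ring
  have hs := Summable.of_nonneg_of_le (fun n => by positivity) hle hgeo.summable
  have hs' : Summable (fun n : ℕ => ‖iteratedDeriv n f 0 / n.factorial‖ * r ^ n) :=
    (summable_nat_add_iff 1).1 hs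
  refine ⟨hs', ?_⟩
  rw [hs'.tsum_eq_zero_add]
  have := hs.tsum_le_tsum hle hgeo.summable
  rw [hgeo.tsum_eq] at this
  simp only [iteratedDeriv_zero, Nat.factorial_zero, Nat.cast_one, div_one, pow_zero, mul_one]
  linarith

/-- A holomorphic function dominated by a constant multiple of another one is its multiple by a
bounded holomorphic function. -/
theorem exists_differentiableOn_mul_eq_of_norm_le {F G : ℂ → ℂ} {U : Set ℂ} (hU : IsOpen U)
    (hUc : IsPreconnected U) (hF : DifferentiableOn ℂ F U) (hG : DifferentiableOn ℂ G U) {k : ℝ}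
    (hk : 0 ≤ k) (hle : ∀ z ∈ U, ‖G z‖ ≤ k * ‖F z‖) :
    ∃ ω : ℂ → ℂ, DifferentiableOn ℂ ω U ∧ (∀ z ∈ U, ‖ω z‖ ≤ k) ∧ ∀ z ∈ U, G z = ω z * F z := by
  by_cases hF0 : Set.EqOn F 0 U
  · refine ⟨0, differentiableOn_const 0, fun z _ => by simpa, fun z hz => ?_⟩
    have h0 : F z = 0 := hF0 hz
    have h1 := hle z hz
    rw [h0, norm_zero, mul_zero, norm_le_zero_iff] at h1
    rw [h1, h0, mul_zero]
  set q : ℂ → ℂ := fun z => G z / F z with hq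
  have hne : ∀ c ∈ U, ∀ᶠ z in 𝓝[≠] c, F z ≠ 0 ∧ z ∈ U := fun c hc => by
    refine Eventually.and ?_ (nhdsWithin_le_nhds (hU.mem_nhds hc))
    by_contra h
    refine hF0 ((hF.analyticOnNhd hU).eqOn_zero_of_preconnected_of_frequently_eq_zero hUc hc ?_)
    exact h
  have hqd : ∀ z, F z ≠ 0 ∧ z ∈ U → DifferentiableAt ℂ q z := fun z hz =>
    (hG.differentiableAt (hU.mem_nhds hz.2)).div (hF.differentiableAt (hU.mem_nhds hz.2)) hz.1
  have hqk : ∀ z, F z ≠ 0 ∧ z ∈ U → ‖q z‖ ≤ k := fun z hz => by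
    rw [hq, norm_div, div_le_iff₀ (norm_pos_iff.2 hz.1)]
    exact hle z hz.2
  have hlim : ∀ c ∈ U, Tendsto q (𝓝[≠] c) (𝓝 (limUnder (𝓝[≠] c) q)) := fun c hc =>
    Complex.tendsto_limUnder_of_differentiable_on_punctured_nhds_of_bounded_under
      ((hne c hc).mono hqd) ⟨k + ‖q c‖, eventually_map.2 <| (hne c hc).mono fun z hz =>
        norm_sub_le_of_le (hqk z hz) le_rfl⟩
  refine ⟨fun z => limUnder (𝓝[≠] z) q, fun c hc => ?_, fun c hc => ?_, fun c hc => ?_⟩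
  · have hs := eventually_nhdsWithin_iff.1 (hne c hc)
    have hd := Complex.differentiableOn_update_limUnder_of_bddAbove hs
      (fun z hz => (hqd z (hz.1 hz.2)).differentiableWithinAt)
      ⟨k, by rintro _ ⟨z, hz, rfl⟩; exact hqk z (hz.1 hz.2)⟩
    refine ((hd.differentiableAt hs).congr_of_eventuallyEq ?_).differentiableWithinAt
    filter_upwards [hs] with z hz
    rcases eq_or_ne z c with rfl | hzc
    · simp
    · rw [Function.update_of_ne hzc]
      exact ((hqd z (hz hzc)).continuousAt.tendsto.mono_left nhdsWithin_le_nhds).limUnder_eq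
  · exact le_of_tendsto (hlim c hc).norm ((hne c hc).mono hqk)
  · have hcont : ∀ {f : ℂ → ℂ}, DifferentiableOn ℂ f U → Tendsto f (𝓝[≠] c) (𝓝 (f c)) :=
      fun hf => (hf.differentiableAt (hU.mem_nhds hc)).continuousAt.tendsto.mono_left
        nhdsWithin_le_nhds
    refine tendsto_nhds_unique_of_eventuallyEq (hcont hG) ((hlim c hc).mul (hcont hF)) ?_
    filter_upwards [hne c hc] with z hz
    exact (div_mul_cancel₀ _ hz.1).symm

theorem hasFPowerSeriesOnBall_ofScalars_of_hasSum {f : ℂ → ℂ} {a : ℕ → ℂ}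
    (hf : ∀ z ∈ ball (0 : ℂ) 1, HasSum (fun n : ℕ => a n * z ^ n) (f z)) :
    HasFPowerSeriesOnBall f (FormalMultilinearSeries.ofScalars ℂ a) 0 1 where
  r_le := by
    refine ENNReal.le_of_forall_nnreal_lt fun r hr => ?_
    apply FormalMultilinearSeries.le_radius_of_summable_norm
    have := (hf (r : ℝ) (by simpa using hr)).summable.norm
    simpa [FormalMultilinearSeries.coeff_ofScalars] using this
  r_pos := one_pos
  hasSum := fun {y} hy => by
    rw [zero_add]
    rw [← ENNReal.ofReal_one, Metric.eball_ofReal] at hy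
    have := hf y hy
    simpa [FormalMultilinearSeries.coeff_ofScalars, mul_comm] using this

theorem iteratedDeriv_eq_factorial_mul_of_hasSum {f : ℂ → ℂ} {a : ℕ → ℂ}
    (hf : ∀ z ∈ ball (0 : ℂ) 1, HasSum (fun n : ℕ => a n * z ^ n) (f z)) (n : ℕ) :
    iteratedDeriv n f 0 = n.factorial * a n := by
  have := (hasFPowerSeriesOnBall_ofScalars_of_hasSum hf).factorial_smul 1 n
  rw [iteratedDeriv_eq_iteratedFDeriv, ← this]
  simp [FormalMultilinearSeries.coeff_ofScalars]

theorem differentiableOn_ball_of_hasSum {f : ℂ → ℂ} {a : ℕ → ℂ}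
    (hf : ∀ z ∈ ball (0 : ℂ) 1, HasSum (fun n : ℕ => a n * z ^ n) (f z)) :
    DifferentiableOn ℂ f (ball 0 1) := by
  have := (hasFPowerSeriesOnBall_ofScalars_of_hasSum hf).differentiableOn
  rwa [← ENNReal.ofReal_one, Metric.eball_ofReal] at this

/-- If `g' = ω h'`, the Taylor coefficients of `g` are dominated by the Cauchy product of those
of `ω` and `h`. -/
theorem norm_coeff_succ_le_of_deriv_eq_mul {h g ω : ℂ → ℂ} {a b : ℕ → ℂ}
    (hh : ∀ z ∈ ball (0 : ℂ) 1, HasSum (fun n : ℕ => a n * z ^ n) (h z))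
    (hg : ∀ z ∈ ball (0 : ℂ) 1, HasSum (fun n : ℕ => b n * z ^ n) (g z))
    (hω : DifferentiableOn ℂ ω (ball 0 1))
    (heq : ∀ z ∈ ball (0 : ℂ) 1, deriv g z = ω z * deriv h z) (n : ℕ) :
    ‖b (n + 1)‖ ≤ ∑ i ∈ Finset.range (n + 1),
      ‖iteratedDeriv i ω 0 / i.factorial‖ * ‖a (n - i + 1)‖ := by
  have hball : ball (0 : ℂ) 1 ∈ 𝓝 0 := ball_mem_nhds 0 one_pos
  have hcd : ∀ {f : ℂ → ℂ}, DifferentiableOn ℂ f (ball 0 1) → ContDiffAt ℂ n f 0 := fun hf =>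
    (hf.analyticAt hball).contDiffAt
  have hprod : iteratedDeriv n (deriv g) 0 = _ :=
    (show deriv g =ᶠ[𝓝 0] fun z => ω z * deriv h z from
      mem_of_superset hball heq).iteratedDeriv_eq n |>.trans <|
    iteratedDeriv_fun_mul (hcd hω) (hcd ((differentiableOn_ball_of_hasSum hh).deriv isOpen_ball))
  simp_rw [← iteratedDeriv_succ', iteratedDeriv_eq_factorial_mul_of_hasSum hh,
    iteratedDeriv_eq_factorial_mul_of_hasSum hg] at hprod
  have hb : b (n + 1) = ∑ i ∈ Finset.range (n + 1),
      iteratedDeriv i ω 0 / i.factorial * a (n - i + 1) * ((n - i + 1 : ℕ) / (n + 1 : ℕ) : ℝ) := by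
    refine mul_left_cancel₀ (Nat.cast_ne_zero.2 (n + 1).factorial_ne_zero) (hprod.trans ?_)
    rw [Finset.mul_sum]
    refine Finset.sum_congr rfl fun i hi => ?_
    have hc : (n.factorial : ℂ) = n.choose i * i.factorial * (n - i).factorial := by
      exact_mod_cast (Nat.choose_mul_factorial_mul_factorial (Finset.mem_range_succ_iff.1 hi)).symm
    have h1 : ((n + 1 : ℕ) : ℂ) ≠ 0 := Nat.cast_ne_zero.2 n.succ_ne_zero
    have h2 : (i.factorial : ℂ) ≠ 0 := Nat.cast_ne_zero.2 i.factorial_ne_zero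
    rw [Nat.factorial_succ, Nat.factorial_succ]
    simp only [Nat.cast_mul, hc, Complex.ofReal_div, Complex.ofReal_natCast]
    field_simp
  rw [hb]
  refine norm_sum_le_of_le _ fun i _ => ?_
  rw [norm_mul, norm_mul, Complex.norm_of_nonneg (by positivity)]
  refine mul_le_of_le_one_right (by positivity) (div_le_one_of_le₀ ?_ (by positivity))
  exact_mod_cast Nat.succ_le_succ (Nat.sub_le n i)

end

/-- If `h = Σ a_n z^n` and `g = Σ b_n z^n` are analytic on the unit disk with
`|g'(z)| ≤ k |h'(z)|` for some `k ∈ (0,1]`, then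
`Σ_{n≥1} |b_n| r^n ≤ k Σ_{n≥1} |a_n| r^n` for `0 ≤ r ≤ 1/3`. -/
theorem stmt11 (h g : ℂ → ℂ) (a b : ℕ → ℂ) (k : ℝ) (hk0 : 0 < k) (hk1 : k ≤ 1)
    (hh : ∀ z ∈ Metric.ball (0:ℂ) 1, HasSum (fun n : ℕ => a n * z ^ n) (h z))
    (hg : ∀ z ∈ Metric.ball (0:ℂ) 1, HasSum (fun n : ℕ => b n * z ^ n) (g z))
    (hderiv : ∀ z ∈ Metric.ball (0:ℂ) 1, ‖deriv g z‖ ≤ k * ‖deriv h z‖) :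
    ∀ r : ℝ, 0 ≤ r → r ≤ 1 / 3 →
      ∑' n : ℕ, ‖b (n + 1)‖ * r ^ (n + 1) ≤ k * ∑' n : ℕ, ‖a (n + 1)‖ * r ^ (n + 1) := by
  intro r hr0 hr
  obtain ⟨ω, hω, hωk, heq⟩ := exists_differentiableOn_mul_eq_of_norm_le Metric.isOpen_ball
    (convex_ball (0 : ℂ) 1).isPreconnected
    ((differentiableOn_ball_of_hasSum hh).deriv Metric.isOpen_ball)
    ((differentiableOn_ball_of_hasSum hg).deriv Metric.isOpen_ball) hk0.le hderiv
  obtain ⟨hw, hwk⟩ := bohr_inequality hω hωk hr0 hr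
  have hrb : (r : ℂ) ∈ Metric.ball (0 : ℂ) 1 := by
    rw [mem_ball_zero_iff, Complex.norm_of_nonneg hr0]
    linarith
  have hsum : ∀ {c : ℕ → ℂ} {f : ℂ → ℂ},
      (∀ z ∈ Metric.ball (0 : ℂ) 1, HasSum (fun n : ℕ => c n * z ^ n) (f z)) →
      Summable fun n : ℕ => ‖c (n + 1)‖ * r ^ (n + 1) := fun {c _} hf =>
    (summable_nat_add_iff (f := fun n => ‖c n‖ * r ^ n) 1).2
      (by simpa [abs_of_nonneg hr0] using (hf r hrb).summable.norm)
  have hle : ∀ n : ℕ, ‖b (n + 1)‖ * r ^ (n + 1) ≤ ∑ i ∈ Finset.range (n + 1),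
      ‖iteratedDeriv i ω 0 / i.factorial‖ * r ^ i * (‖a (n - i + 1)‖ * r ^ (n - i + 1)) := by
    intro n
    refine (mul_le_mul_of_nonneg_right (norm_coeff_succ_le_of_deriv_eq_mul hh hg hω heq n)
      (by positivity)).trans_eq ?_
    rw [Finset.sum_mul]
    refine Finset.sum_congr rfl fun i hi => ?_
    have hpow : r ^ (n + 1) = r ^ i * r ^ (n - i + 1) := by
      rw [← pow_add, ← add_assoc, Nat.add_sub_cancel' (Finset.mem_range_succ_iff.1 hi)]
    rw [hpow]
    ring
  have hprod := tsum_mul_tsum_eq_tsum_sum_range_of_summable_norm hw.norm (hsum hh).norm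
  have hprods := (summable_norm_sum_mul_range_of_summable_norm hw.norm (hsum hh).norm).of_norm
  refine ((hsum hg).tsum_le_tsum hle hprods).trans (hprod.symm.trans_le ?_)
  exact mul_le_mul_of_nonneg_right hwk (tsum_nonneg fun n => by positivity)
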